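/- arXiv:2010.12535 — 2 statements merged into one kernel-verified Lean document; each statement's English description precedes it below -/
import Mathlib

section
/- (Correctness of the STORE circuit.) Let U be the two-qubit unitary on an electron qubit e (first factor) and a nuclear qubit n (second factor) given by the composition, in order of application: R_Z(−π/2) on n; the electron-controlled rotation CR_X(π/2) = |0⟩⟨0|_e⊗R_X(π/2)_n + |1⟩⟨1|_e⊗R_X(−π/2)_n; R_Z(π/2) on n; R_X(π/2) on e; CR_X(π/2); and R_Y(−π/2) on e. Then there exists a unit-modulus complex number λ such that for every single-qubit state |ψ⟩ ∈ ℂ², U(|ψ⟩ ⊗ |0⟩) = λ · |0⟩ ⊗ (H|ψ⟩), i.e. the circuit moves the electron state onto the nuclear spin in the Hadamard-rotated basis, leaving the electron in |0⟩. -/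
open Matrix
open scoped Kronecker ComplexConjugate

noncomputable section

abbrev M2 : Type := Matrix (Fin 2) (Fin 2) ℂ

def σX : M2 := !![0, 1; 1, 0]
def σY : M2 := !![0, -Complex.I; Complex.I, 0]
def σZ : M2 := !![1, 0; 0, -1]

/-- The Hadamard gate. -/
def Hgate : M2 := (Real.sqrt 2 : ℂ)⁻¹ • !![1, 1; 1, -1]

def ket0 : Fin 2 → ℂ := ![1, 0]
def ket1 : Fin 2 → ℂ := ![0, 1]

/-- Tensor product of two single-qubit vectors. -/
def tp (v w : Fin 2 → ℂ) : Fin 2 × Fin 2 → ℂ := fun p => v p.1 * w p.2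

/-- The Bell states `|φ[s,t]⟩` for `s, t ∈ {1, -1}`:
`|φ[s,1]⟩ = (|00⟩ + s|11⟩)/√2` and `|φ[s,-1]⟩ = (|01⟩ + s|10⟩)/√2`. -/
def bell (s t : ℤ) : Fin 2 × Fin 2 → ℂ :=
  (Real.sqrt 2 : ℂ)⁻¹ •
    (if t = 1 then tp ket0 ket0 + (s : ℂ) • tp ket1 ket1
     else tp ket0 ket1 + (s : ℂ) • tp ket1 ket0)


/-- Single-qubit rotation `R_X(θ) = cos(θ/2)·I − i·sin(θ/2)·X`. -/
def RX (θ : ℝ) : M2 :=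
  (Real.cos (θ / 2) : ℂ) • (1 : M2) - (Complex.I * (Real.sin (θ / 2) : ℂ)) • σX

/-- Single-qubit rotation `R_Y(θ) = cos(θ/2)·I − i·sin(θ/2)·Y`. -/
def RY (θ : ℝ) : M2 :=
  (Real.cos (θ / 2) : ℂ) • (1 : M2) - (Complex.I * (Real.sin (θ / 2) : ℂ)) • σY

/-- Single-qubit rotation `R_Z(θ) = cos(θ/2)·I − i·sin(θ/2)·Z`. -/
def RZ (θ : ℝ) : M2 :=
  (Real.cos (θ / 2) : ℂ) • (1 : M2) - (Complex.I * (Real.sin (θ / 2) : ℂ)) • σZ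

def proj0 : M2 := !![1, 0; 0, 0]
def proj1 : M2 := !![0, 0; 0, 1]

/-- The electron-controlled rotation `CR_X(θ) = |0⟩⟨0|⊗R_X(θ) + |1⟩⟨1|⊗R_X(−θ)`
(first factor = electron, second factor = nuclear qubit). -/
def CRX (θ : ℝ) : Matrix (Fin 2 × Fin 2) (Fin 2 × Fin 2) ℂ :=
  proj0 ⊗ₖ RX θ + proj1 ⊗ₖ RX (-θ)

/-- The STORE circuit, in order of application: `R_Z(−π/2)` on the nuclear qubit;
`CR_X(π/2)`; `R_Z(π/2)` on the nuclear qubit; `R_X(π/2)` on the electron; `CR_X(π/2)`;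
and `R_Y(−π/2)` on the electron. -/
def storeCircuit : Matrix (Fin 2 × Fin 2) (Fin 2 × Fin 2) ℂ :=
  (RY (-(Real.pi / 2)) ⊗ₖ (1 : M2)) * CRX (Real.pi / 2) * (RX (Real.pi / 2) ⊗ₖ (1 : M2)) *
    ((1 : M2) ⊗ₖ RZ (Real.pi / 2)) * CRX (Real.pi / 2) * ((1 : M2) ⊗ₖ RZ (-(Real.pi / 2)))

theorem ofReal_cos_pi_div_two_div_two :
    (Real.cos (Real.pi / 2 / 2) : ℂ) = (Real.sqrt 2 : ℂ)⁻¹ := by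
  rw [show Real.pi / 2 / 2 = Real.pi / 4 by ring, Real.cos_pi_div_four,
    ← Complex.ofReal_inv, Real.sqrt_div_self', one_div]

theorem ofReal_sin_pi_div_two_div_two :
    (Real.sin (Real.pi / 2 / 2) : ℂ) = (Real.sqrt 2 : ℂ)⁻¹ := by
  rw [show Real.pi / 2 / 2 = Real.pi / 4 by ring, Real.sin_pi_div_four,
    ← Complex.ofReal_inv, Real.sqrt_div_self', one_div]

theorem RX_pi_div_two :
    RX (Real.pi / 2) = (Real.sqrt 2 : ℂ)⁻¹ • !![1, -Complex.I; -Complex.I, 1] := by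
  rw [RX, ofReal_cos_pi_div_two_div_two, ofReal_sin_pi_div_two_div_two]
  ext i j
  fin_cases i <;> fin_cases j <;> simp [σX, mul_comm]

theorem RX_neg_pi_div_two :
    RX (-(Real.pi / 2)) = (Real.sqrt 2 : ℂ)⁻¹ • !![1, Complex.I; Complex.I, 1] := by
  rw [RX, neg_div, Real.cos_neg, Real.sin_neg, Complex.ofReal_neg,
    ofReal_cos_pi_div_two_div_two, ofReal_sin_pi_div_two_div_two]
  ext i j
  fin_cases i <;> fin_cases j <;> simp [σX, mul_comm]

theorem RY_neg_pi_div_two :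
    RY (-(Real.pi / 2)) = (Real.sqrt 2 : ℂ)⁻¹ • !![1, 1; -1, 1] := by
  rw [RY, neg_div, Real.cos_neg, Real.sin_neg, Complex.ofReal_neg,
    ofReal_cos_pi_div_two_div_two, ofReal_sin_pi_div_two_div_two]
  ext i j
  fin_cases i <;> fin_cases j <;> simp [σY, mul_right_comm]

theorem RZ_pi_div_two :
    RZ (Real.pi / 2) = (Real.sqrt 2 : ℂ)⁻¹ • !![1 - Complex.I, 0; 0, 1 + Complex.I] := by
  rw [RZ, ofReal_cos_pi_div_two_div_two, ofReal_sin_pi_div_two_div_two]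
  ext i j
  fin_cases i <;> fin_cases j <;> simp [σZ] <;> ring

theorem RZ_neg_pi_div_two :
    RZ (-(Real.pi / 2)) = (Real.sqrt 2 : ℂ)⁻¹ • !![1 + Complex.I, 0; 0, 1 - Complex.I] := by
  rw [RZ, neg_div, Real.cos_neg, Real.sin_neg, Complex.ofReal_neg,
    ofReal_cos_pi_div_two_div_two, ofReal_sin_pi_div_two_div_two]
  ext i j
  fin_cases i <;> fin_cases j <;> simp [σZ] <;> ring

theorem CRX_pi_div_two :
    CRX (Real.pi / 2) = (Real.sqrt 2 : ℂ)⁻¹ •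
      (proj0 ⊗ₖ !![1, -Complex.I; -Complex.I, 1] + proj1 ⊗ₖ !![1, Complex.I; Complex.I, 1]) := by
  rw [CRX, RX_pi_div_two, RX_neg_pi_div_two, kronecker_smul, kronecker_smul, smul_add]

theorem inv_sqrt_two_sq : ((Real.sqrt 2 : ℂ)⁻¹) ^ 2 = 1 / 2 := by
  rw [inv_pow, ← Complex.ofReal_pow, Real.sq_sqrt zero_le_two]
  norm_num

/-- Correctness of the STORE circuit: there is a unit-modulus `λ` such that for every
single-qubit state `|ψ⟩`, `U(|ψ⟩ ⊗ |0⟩) = λ · |0⟩ ⊗ (H|ψ⟩)`. -/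
theorem store_circuit_correct :
    ∃ lam : ℂ, ‖lam‖ = 1 ∧ ∀ ψ : Fin 2 → ℂ,
      storeCircuit.mulVec (tp ψ ket0) = lam • tp ket0 (Hgate.mulVec ψ) := by
  refine ⟨(Real.sqrt 2 : ℂ)⁻¹ * (1 - Complex.I), ?_, fun ψ => ?_⟩
  · have h : ‖(1 : ℂ) - Complex.I‖ = Real.sqrt 2 := by
      rw [Complex.norm_def]
      norm_num [Complex.normSq_apply]
    rw [norm_mul, h, norm_inv, Complex.norm_of_nonneg (Real.sqrt_nonneg 2)]
    exact inv_mul_cancel₀ (by positivity)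
  · rw [storeCircuit, CRX_pi_div_two, RX_pi_div_two, RY_neg_pi_div_two, RZ_pi_div_two,
      RZ_neg_pi_div_two, Hgate]
    have h2 := inv_sqrt_two_sq
    generalize (Real.sqrt 2 : ℂ)⁻¹ = s at h2 ⊢
    have h6 : s * (s * (s * (s * (s * s)))) = 1 / 8 := by
      linear_combination (s ^ 4 + s ^ 2 / 2 + 1 / 4) * h2
    have hI5 : Complex.I ^ 5 = Complex.I := by
      rw [pow_succ, Complex.I_pow_four, one_mul]
    simp only [smul_kronecker, kronecker_smul, Matrix.smul_mul, Matrix.mul_smul, smul_smul, mul_assoc, h6]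
    rw [smul_mulVec]
    ext ⟨i, j⟩
    fin_cases i <;> fin_cases j <;>
      simp [mulVec, dotProduct, mul_apply, Fintype.sum_prod_type, tp, ket0, proj0, proj1, one_apply]
    all_goals
      ring_nf
      try simp only [h2, Complex.I_sq, Complex.I_pow_three, Complex.I_pow_four, hI5]
      try ring
end
end

section
/- (Correctness of the correction-operator update for entanglement swapping.) Let P_A, P_M^A, P_M^B, P_B be single-qubit Pauli operators and (a,b) ∈ {1,−1}², and let Q(a,b) be given by Q(1,1) = X, Q(1,−1) = I, Q(−1,1) = Y, Q(−1,−1) = Z. Consider the four-qubit state (P_A ⊗ P_M^A ⊗ P_M^B ⊗ P_B)(|φ[1,−1]⟩₁₂ ⊗ |φ[1,−1]⟩₃₄). Projecting qubits 2 and 3 onto the Bell state |φ[a,b]⟩ leaves qubits 1 and 4, up to normalization and a unit-modulus phase, in the state (P_A ⊗ P_M^A·P_M^B·P_B·Q(a,b))|φ[1,−1]⟩; in particular the updated correction Paulis P_A (at node A) and P_M^A·P_M^B·P_B·Q(a,b) (at node B) again map the post-swap state to |φ[1,−1]⟩ up to phase. -/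
open Matrix
open scoped Kronecker ComplexConjugate

noncomputable section

/-- The set of single-qubit Pauli operators `{I, X, Y, Z}`. -/
def pauliSet : Set M2 := {1, σX, σY, σZ}

/-- The correction Pauli `Q(a,b)`: `Q(1,1) = X`, `Q(1,−1) = I`, `Q(−1,1) = Y`,
`Q(−1,−1) = Z`. -/
def Qcorr (a b : ℤ) : M2 :=
  if a = 1 then (if b = 1 then σX else 1) else (if b = 1 then σY else σZ)

/-- Two operators agree up to a unit-modulus phase. -/
def PhaseEq {R : Type*} [Ring R] [Algebra ℂ R] (A B : R) : Prop :=
  ∃ u : ℂ, ‖u‖ = 1 ∧ A = u • B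

namespace PhaseEq

variable {R : Type*} [Ring R] [Algebra ℂ R] {A B C D : R}

theorem refl (A : R) : PhaseEq A A := ⟨1, by simp, by simp⟩

theorem symm (h : PhaseEq A B) : PhaseEq B A := by
  obtain ⟨u, hu, rfl⟩ := h
  have hu0 : u ≠ 0 := norm_ne_zero_iff.mp (by simp [hu])
  exact ⟨u⁻¹, by simp [hu], by simp [smul_smul, hu0]⟩

theorem trans (h : PhaseEq A B) (h' : PhaseEq B C) : PhaseEq A C := by
  obtain ⟨u, hu, rfl⟩ := h
  obtain ⟨v, hv, rfl⟩ := h'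
  exact ⟨u * v, by simp [hu, hv], by simp [smul_smul]⟩

theorem mul (h : PhaseEq A B) (h' : PhaseEq C D) : PhaseEq (A * C) (B * D) := by
  obtain ⟨u, hu, rfl⟩ := h
  obtain ⟨v, hv, rfl⟩ := h'
  exact ⟨u * v, by simp [hu, hv], by simp [smul_smul, mul_comm]⟩

instance : Trans (PhaseEq (R := R)) (PhaseEq (R := R)) (PhaseEq (R := R)) := ⟨trans⟩

theorem comm_mul (hB : PhaseEq (A * B) (B * A)) (hC : PhaseEq (A * C) (C * A)) :
    PhaseEq (A * (B * C)) (B * C * A) := by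
  have h₁ := hB.mul (refl C)
  have h₂ := (refl B).mul hC
  simp only [mul_assoc] at h₁ h₂ ⊢
  exact h₁.trans h₂

theorem mul_self_mul (hA : PhaseEq (A * A) 1) (hB : PhaseEq (B * B) 1)
    (hAB : PhaseEq (A * B) (B * A)) : PhaseEq (A * B * (A * B)) 1 := by
  have h₁ := ((refl A).mul hAB.symm).mul (refl B)
  have h₂ := hA.mul hB
  simp only [mul_assoc, mul_one] at h₁ h₂ ⊢
  exact h₁.trans h₂

end PhaseEq

theorem σX_mem_pauliSet : σX ∈ pauliSet := by simp [pauliSet]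

theorem Qcorr_mem_pauliSet (a b : ℤ) : Qcorr a b ∈ pauliSet := by
  unfold Qcorr pauliSet
  split_ifs <;> simp

theorem pauli_mul_self {P : M2} (hP : P ∈ pauliSet) : P * P = 1 := by
  rcases hP with rfl | rfl | rfl | rfl <;>
    ext i j <;> fin_cases i <;> fin_cases j <;> simp [σX, σY, σZ]

theorem pauli_transpose_phaseEq {P : M2} (hP : P ∈ pauliSet) : PhaseEq Pᵀ P := by
  have h : Pᵀ = P ∨ Pᵀ = -P := by
    rcases hP with rfl | rfl | rfl | rfl
    · left; simp
    · left; ext i j; fin_cases i <;> fin_cases j <;> simp [σX]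
    · right; ext i j; fin_cases i <;> fin_cases j <;> simp [σY]
    · left; ext i j; fin_cases i <;> fin_cases j <;> simp [σZ]
  rcases h with h | h
  · exact ⟨1, by simp, by simp [h]⟩
  · exact ⟨-1, by simp, by simp [h]⟩

theorem pauli_mul_comm_phaseEq {P Q : M2} (hP : P ∈ pauliSet) (hQ : Q ∈ pauliSet) :
    PhaseEq (P * Q) (Q * P) := by
  rcases hP with rfl | rfl | rfl | rfl <;> rcases hQ with rfl | rfl | rfl | rfl <;>
    first
    | (refine ⟨1, by simp, ?_⟩; simp; done)
    | exact ⟨-1, by simp, by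
        ext i j; fin_cases i <;> fin_cases j <;> simp [σX, σY, σZ]⟩

/-- The coefficient matrix of `√2 |φ[s,t]⟩`. -/
def bellMatrix (s t : ℤ) : M2 :=
  if t = 1 then !![1, 0; 0, (s : ℂ)] else !![0, 1; (s : ℂ), 0]

theorem bell_apply (s t : ℤ) (p : Fin 2 × Fin 2) :
    bell s t p = (Real.sqrt 2 : ℂ)⁻¹ * bellMatrix s t p.1 p.2 := by
  obtain ⟨i, j⟩ := p
  unfold bell bellMatrix
  split_ifs <;> fin_cases i <;> fin_cases j <;> simp [tp, ket0, ket1]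

theorem bellMatrix_one_neg_one : bellMatrix 1 (-1) = σX := by
  simp [bellMatrix, σX]

theorem kronecker_mulVec_bell (A B : M2) (p : Fin 2 × Fin 2) :
    (A ⊗ₖ B).mulVec (bell 1 (-1)) p =
      (Real.sqrt 2 : ℂ)⁻¹ * (A * σX * Bᵀ) p.1 p.2 := by
  simp only [Matrix.mulVec, dotProduct, bell_apply, bellMatrix_one_neg_one,
    Fintype.sum_prod_type, Fin.sum_univ_two, Matrix.kroneckerMap_apply, Matrix.mul_apply,
    Matrix.transpose_apply]
  ring

theorem bellMatrix_mul_σX_phaseEq {a b : ℤ} (ha : a ∈ ({1, -1} : Set ℤ))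
    (hb : b ∈ ({1, -1} : Set ℤ)) : PhaseEq (bellMatrix a b * σX) (Qcorr a b) := by
  rcases ha with rfl | rfl <;> rcases hb with rfl | rfl
  · exact ⟨1, by simp, by
      ext i j; fin_cases i <;> fin_cases j <;> simp [bellMatrix, Qcorr, σX]⟩
  · exact ⟨1, by simp, by
      ext i j; fin_cases i <;> fin_cases j <;> simp [bellMatrix, Qcorr, σX]⟩
  · exact ⟨Complex.I, by simp, by
      ext i j; fin_cases i <;> fin_cases j <;> simp [bellMatrix, Qcorr, σX, σY]⟩
  · exact ⟨1, by simp, by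
      ext i j; fin_cases i <;> fin_cases j <;> simp [bellMatrix, Qcorr, σX, σZ]⟩

theorem conj_bell_apply (s t : ℤ) (p : Fin 2 × Fin 2) :
    conj (bell s t p) = bell s t p := by
  obtain ⟨i, j⟩ := p
  rw [bell_apply]
  unfold bellMatrix
  split_ifs <;> fin_cases i <;> fin_cases j <;> simp

theorem swap_pauli_phaseEq {P Q S : M2} (hP : P ∈ pauliSet) (hQ : Q ∈ pauliSet)
    (hS : S ∈ pauliSet) {a b : ℤ} (ha : a ∈ ({1, -1} : Set ℤ))
    (hb : b ∈ ({1, -1} : Set ℤ)) :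
    PhaseEq (Pᵀ * bellMatrix a b * Q * σX * Sᵀ) (P * Q * S * Qcorr a b)ᵀ := by
  have hK := Qcorr_mem_pauliSet a b
  have hB := bellMatrix_mul_σX_phaseEq ha hb
  have tP := pauli_transpose_phaseEq hP
  have tQ := pauli_transpose_phaseEq hQ
  have tS := pauli_transpose_phaseEq hS
  have tK := pauli_transpose_phaseEq hK
  have hmid : PhaseEq (bellMatrix a b * Q * σX) (Qcorr a b * Q) := by
    have h₁ := (PhaseEq.refl (bellMatrix a b)).mul (pauli_mul_comm_phaseEq hQ σX_mem_pauliSet)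
    rw [← mul_assoc, ← mul_assoc] at h₁
    exact h₁.trans (hB.mul (PhaseEq.refl Q))
  have e : Pᵀ * bellMatrix a b * Q * σX * Sᵀ = Pᵀ * (bellMatrix a b * Q * σX * Sᵀ) := by
    simp only [mul_assoc]
  rw [e]
  calc
    PhaseEq _ (P * (Qcorr a b * Q * S)) := tP.mul (hmid.mul tS)
    PhaseEq _ (Qcorr a b * Q * S * P) :=
      PhaseEq.comm_mul
        (PhaseEq.comm_mul (pauli_mul_comm_phaseEq hP hK) (pauli_mul_comm_phaseEq hP hQ))
        (pauli_mul_comm_phaseEq hP hS)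
    PhaseEq _ (Qcorr a b * (S * Q) * P) := by
      rw [mul_assoc (Qcorr a b)]
      exact ((PhaseEq.refl _).mul (pauli_mul_comm_phaseEq hQ hS)).mul (PhaseEq.refl P)
    PhaseEq _ (P * Q * S * Qcorr a b)ᵀ := by
      simpa only [Matrix.transpose_mul, mul_assoc] using
        (tK.mul ((tS.mul tQ).mul tP)).symm

theorem pauli_four_mul_self_phaseEq {P Q S T : M2} (hP : P ∈ pauliSet) (hQ : Q ∈ pauliSet)
    (hS : S ∈ pauliSet) (hT : T ∈ pauliSet) :
    PhaseEq (P * Q * S * T * (P * Q * S * T)) 1 := by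
  have sq {A : M2} (hA : A ∈ pauliSet) : PhaseEq (A * A) 1 := by
    rw [pauli_mul_self hA]; exact PhaseEq.refl 1
  have comm {A B : M2} (hA : A ∈ pauliSet) (hB : B ∈ pauliSet) :=
    pauli_mul_comm_phaseEq hA hB
  refine PhaseEq.mul_self_mul (PhaseEq.mul_self_mul
    (PhaseEq.mul_self_mul (sq hP) (sq hQ) (comm hP hQ)) (sq hS) ?_) (sq hT) ?_
  · exact (PhaseEq.comm_mul (comm hS hP) (comm hS hQ)).symm
  · exact (PhaseEq.comm_mul (PhaseEq.comm_mul (comm hT hP) (comm hT hQ)) (comm hT hS)).symm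

/-- Correctness of the correction-operator update for entanglement swapping:
projecting qubits 2 and 3 of `(P_A ⊗ P_M^A ⊗ P_M^B ⊗ P_B)(|φ[1,−1]⟩₁₂ ⊗ |φ[1,−1]⟩₃₄)`
onto `|φ[a,b]⟩` leaves qubits 1 and 4, up to normalization and a unit-modulus phase, in
the state `(P_A ⊗ P_M^A·P_M^B·P_B·Q(a,b))|φ[1,−1]⟩`; in particular the updated
correction Paulis again map the post-swap state to `|φ[1,−1]⟩` up to phase. -/
theorem swap_correction_update (PA PMA PMB PB : M2)
    (hPA : PA ∈ pauliSet) (hPMA : PMA ∈ pauliSet)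
    (hPMB : PMB ∈ pauliSet) (hPB : PB ∈ pauliSet)
    (a b : ℤ) (ha : a ∈ ({1, -1} : Set ℤ)) (hb : b ∈ ({1, -1} : Set ℤ)) :
    (∃ lam : ℂ, ‖lam‖ = 1 ∧
      (fun x : Fin 2 × Fin 2 =>
          ∑ y : Fin 2 × Fin 2,
            conj (bell a b y) *
              (((PA ⊗ₖ PMA).mulVec (bell 1 (-1))) (x.1, y.1) *
                ((PMB ⊗ₖ PB).mulVec (bell 1 (-1))) (y.2, x.2)))
        = (lam * (1 / 2 : ℂ)) •
            ((PA ⊗ₖ (PMA * PMB * PB * Qcorr a b)).mulVec (bell 1 (-1)))) ∧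
    (∃ mu : ℂ, ‖mu‖ = 1 ∧
      (PA ⊗ₖ (PMA * PMB * PB * Qcorr a b)).mulVec
          ((PA ⊗ₖ (PMA * PMB * PB * Qcorr a b)).mulVec (bell 1 (-1)))
        = mu • bell 1 (-1)) := by
  constructor
  · obtain ⟨u, hu, h⟩ := swap_pauli_phaseEq hPMA hPMB hPB ha hb
    refine ⟨u, hu, ?_⟩
    have hs : (Real.sqrt 2 : ℂ)⁻¹ * (Real.sqrt 2 : ℂ)⁻¹ = 1 / 2 := by
      rw [← mul_inv, ← Complex.ofReal_mul, Real.mul_self_sqrt (by norm_num)]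
      norm_num
    have h' : PA * σX * PMAᵀ * bellMatrix a b * (PMB * σX * PBᵀ) =
        u • (PA * σX * (PMA * PMB * PB * Qcorr a b)ᵀ) := by
      rw [← Matrix.mul_smul, ← h]
      simp only [mul_assoc]
    funext x
    simp only [conj_bell_apply]
    simp only [Pi.smul_apply, smul_eq_mul, kronecker_mulVec_bell, bell_apply]
    have hx := congrFun (congrFun h' x.1) x.2
    rw [Matrix.smul_apply, smul_eq_mul] at hx
    calc
      _ = ((Real.sqrt 2 : ℂ)⁻¹ * (Real.sqrt 2 : ℂ)⁻¹) * (Real.sqrt 2 : ℂ)⁻¹ *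
          (PA * σX * PMAᵀ * bellMatrix a b * (PMB * σX * PBᵀ)) x.1 x.2 := by
        rw [Matrix.mul_apply]
        simp only [Matrix.mul_apply (M := PA * σX * PMAᵀ), Fintype.sum_prod_type,
          Fin.sum_univ_two]
        ring
      _ = _ := by
        rw [hx, hs]
        ring
  · obtain ⟨u, hu, h⟩ := pauli_four_mul_self_phaseEq hPMA hPMB hPB (Qcorr_mem_pauliSet a b)
    refine ⟨u, hu, ?_⟩
    rw [Matrix.mulVec_mulVec, ← Matrix.mul_kronecker_mul, pauli_mul_self hPA, h,
      Matrix.kronecker_smul, Matrix.one_kronecker_one, Matrix.smul_mulVec, Matrix.one_mulVec]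
end
end
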